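/- Let H : [0,∞) → [0,∞) be continuous, convex and strictly increasing with H(0) = 0. Let ξ : [0,∞) → (0,∞) be non-increasing and let g : [0,∞) → (0,∞) be differentiable and non-increasing with g′(s) ≤ −ξ(s) H(g(s)) for all s ≥ 0. Fix t > 0, let θ : [0,t] → [0,∞) be integrable, and let q ∈ (0,1) satisfy q ∫₀^t θ(s) ds ≤ 1. Then H( q ∫₀^t g(s) θ(s) ds ) ≤ (q/ξ(t)) · ( −∫₀^t g′(s) θ(s) ds ); equivalently, ∫₀^t g(s) θ(s) ds ≤ (1/q) H⁻¹( q μ(t) / ξ(t) ) with μ(t) := −∫₀^t g′(s) θ(s) ds. -/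

import Mathlib

open MeasureTheory

/-- A convex function on `S` has a supporting line at every interior point of `S`. -/
theorem ConvexOn.exists_supporting_line_of_mem_interior {S : Set ℝ} {f : ℝ → ℝ} {x : ℝ}
    (hf : ConvexOn ℝ S f) (hx : x ∈ interior S) :
    ∃ m, ∀ y ∈ S, f x + m * (y - x) ≤ f y := by
  refine ⟨derivWithin f (Set.Ioi x) x, fun y hy ↦ ?_⟩
  rcases lt_trichotomy x y with hxy | rfl | hyx
  · have h := hf.rightDeriv_le_slope_of_mem_interior hx hy hxy
    rw [slope_def_field, le_div_iff₀ (sub_pos.2 hxy)] at h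
    linarith
  · simp
  · have h := (hf.slope_le_leftDeriv_of_mem_interior hy hx hyx).trans
      (hf.leftDeriv_le_rightDeriv_of_mem_interior hx)
    rw [slope_def_field, div_le_iff₀ (sub_pos.2 hyx)] at h
    linarith

theorem jensen_kernel_estimate
    (H : ℝ → ℝ)
    (hHcont : ContinuousOn H (Set.Ici 0))
    (hHconv : ConvexOn ℝ (Set.Ici 0) H)
    (hHmono : StrictMonoOn H (Set.Ici 0))
    (hH0 : H 0 = 0)
    (ξ : ℝ → ℝ)
    (hξpos : ∀ s, 0 ≤ s → 0 < ξ s)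
    (hξmono : ∀ s₁ s₂, 0 ≤ s₁ → s₁ ≤ s₂ → ξ s₂ ≤ ξ s₁)
    (g : ℝ → ℝ)
    (hgpos : ∀ s, 0 ≤ s → 0 < g s)
    (hgdiff : ∀ s, 0 ≤ s → DifferentiableAt ℝ g s)
    (hgmono : ∀ s₁ s₂, 0 ≤ s₁ → s₁ ≤ s₂ → g s₂ ≤ g s₁)
    (hgH : ∀ s, 0 ≤ s → deriv g s ≤ -ξ s * H (g s))
    (t : ℝ) (ht : 0 < t)
    (θ : ℝ → ℝ)
    (hθnonneg : ∀ s ∈ Set.Icc (0:ℝ) t, 0 ≤ θ s)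
    (hθint : IntervalIntegrable θ volume 0 t)
    (hgθint : IntervalIntegrable (fun s => g s * θ s) volume 0 t)
    (hg'θint : IntervalIntegrable (fun s => deriv g s * θ s) volume 0 t)
    (q : ℝ) (hq0 : 0 < q) (hq1 : q < 1)
    (hqθ : q * ∫ s in (0:ℝ)..t, θ s ≤ 1) :
    H (q * ∫ s in (0:ℝ)..t, g s * θ s)
      ≤ q / ξ t * -∫ s in (0:ℝ)..t, deriv g s * θ s := by
  have hHnonneg : ∀ x, 0 ≤ x → 0 ≤ H x := fun x hx ↦
    hH0 ▸ hHmono.monotoneOn Set.self_mem_Ici hx hx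
  have hξt := hξpos t ht.le
  have hbound : ∀ s ∈ Set.Icc 0 t, ξ t * (H (g s) * θ s) ≤ -(deriv g s * θ s) := by
    intro s hs
    have h₁ := mul_le_mul_of_nonneg_right (hξmono s t hs.1 hs.2)
      (hHnonneg (g s) (hgpos s hs.1).le)
    have h₂ := mul_le_mul_of_nonneg_right
      (show ξ t * H (g s) ≤ -deriv g s by linarith [hgH s hs.1]) (hθnonneg s hs)
    linarith
  set x := q * ∫ s in (0:ℝ)..t, g s * θ s with hx
  have hx0 : 0 ≤ x := mul_nonneg hq0.le <| intervalIntegral.integral_nonneg ht.le fun s hs ↦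
    mul_nonneg (hgpos s hs.1).le (hθnonneg s hs)
  rcases hx0.eq_or_lt with hx0 | hx0
  · rw [← hx0, hH0, ← intervalIntegral.integral_neg]
    refine mul_nonneg (div_pos hq0 hξt).le <| intervalIntegral.integral_nonneg ht.le fun s hs ↦ ?_
    exact (mul_nonneg hξt.le (mul_nonneg (hHnonneg _ (hgpos s hs.1).le)
      (hθnonneg s hs))).trans (hbound s hs)
  obtain ⟨m, hm⟩ := hHconv.exists_supporting_line_of_mem_interior
    (show x ∈ interior (Set.Ici 0) by rwa [interior_Ici])
  have hc : H x - m * x ≤ 0 := by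
    have := hm 0 Set.self_mem_Ici
    linarith
  have hint : ξ t * ((H x - m * x) * (∫ s in (0:ℝ)..t, θ s) + m * ∫ s in (0:ℝ)..t, g s * θ s)
      ≤ -∫ s in (0:ℝ)..t, deriv g s * θ s := by
    rw [← intervalIntegral.integral_neg, ← intervalIntegral.integral_const_mul,
      ← intervalIntegral.integral_const_mul,
      ← intervalIntegral.integral_add (hθint.const_mul _) (hgθint.const_mul _),
      ← intervalIntegral.integral_const_mul]
    refine intervalIntegral.integral_mono_on ht.le
      (((hθint.const_mul _).add (hgθint.const_mul _)).const_mul _) hg'θint.neg fun s hs ↦ ?_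
    have h := mul_le_mul_of_nonneg_right (hm (g s) (hgpos s hs.1).le) (hθnonneg s hs)
    refine le_trans (mul_le_mul_of_nonneg_left ?_ hξt.le) (hbound s hs)
    linarith
  rw [div_mul_eq_mul_div, le_div_iff₀ hξt]
  calc H x * ξ t
      ≤ ξ t * ((H x - m * x) * (q * ∫ s in (0:ℝ)..t, θ s) + m * x) := by
        rw [mul_comm]
        refine mul_le_mul_of_nonneg_left ?_ hξt.le
        linarith [mul_le_mul_of_nonpos_left hqθ hc]
    _ = q * (ξ t * ((H x - m * x) * (∫ s in (0:ℝ)..t, θ s)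
          + m * ∫ s in (0:ℝ)..t, g s * θ s)) := by
        linear_combination ξ t * m * hx
    _ ≤ q * -∫ s in (0:ℝ)..t, deriv g s * θ s := mul_le_mul_of_nonneg_left hint hq0.le
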